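/- In the three-path game, the constant randomized strategy profile h⁰ with h⁰(i) = (5/6, 0, 1/6) for every i ∈ I is a randomized strategy robust perfect equilibrium; it is the unique symmetric randomized strategy robust perfect equilibrium (λ-almost everywhere); and every randomized strategy robust perfect equilibrium h satisfies ∫_I h(i) dλ(i) = (5/6, 0, 1/6). -/

import Mathlib

open MeasureTheory Filter Topology

section RobustPerfect

variable {I : Type*} [MeasurableSpace I] {A : Type*} [Fintype A]

/-- The societal summary of a randomized strategy profile. -/
noncomputable def socSum (lam : Measure I) (h : I → A → ℝ) : A → ℝ :=
  fun a => ∫ i, h i a ∂lam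

/-- `h` is a randomized strategy profile: a measurable map into the simplex. -/
def IsProfile (lam : Measure I) (h : I → A → ℝ) : Prop :=
  Measurable h ∧ ∀ i, h i ∈ stdSimplex ℝ A

/-- A large game: payoffs continuous on the simplex and measurable in the player. -/
def IsLargeGame (u : I → A → (A → ℝ) → ℝ) : Prop :=
  (∀ i a, ContinuousOn (u i a) (stdSimplex ℝ A)) ∧
  (∀ (a : A) (τ : A → ℝ), τ ∈ stdSimplex ℝ A → Measurable fun i => u i a τ)

/-- An atomless measure. -/
def MeasAtomless (lam : Measure I) : Prop :=
  ∀ s : Set I, MeasurableSet s → 0 < lam s →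
    ∃ t : Set I, MeasurableSet t ∧ t ⊆ s ∧ 0 < lam t ∧ lam t < lam s

/-- A Borel probability measure concentrated on the simplex with full support on it. -/
def FullSupportOnSimplex (η : Measure (A → ℝ)) : Prop :=
  IsProbabilityMeasure η ∧ η (stdSimplex ℝ A)ᶜ = 0 ∧
    ∀ U : Set (A → ℝ), IsOpen U → (U ∩ stdSimplex ℝ A).Nonempty → 0 < η U

/-- A perturbation function: a Borel measurable map from the simplex to the
full-support Borel probability measures on the simplex. -/
def IsPerturbation (φ : (A → ℝ) → Measure (A → ℝ)) : Prop :=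
  (∀ τ ∈ stdSimplex ℝ A, FullSupportOnSimplex (φ τ)) ∧
  ∀ f : (A → ℝ) → ℝ, Continuous f → Measurable fun τ => ∫ x, f x ∂(φ τ)

/-- Expected payoff of action `a` against a distribution over societal summaries. -/
noncomputable def payM (ui : A → (A → ℝ) → ℝ) (a : A) (ν : Measure (A → ℝ)) : ℝ :=
  ∫ τ, ui a τ ∂ν

/-- Randomized strategy Nash equilibrium. -/
def IsNash (lam : Measure I) (u : I → A → (A → ℝ) → ℝ) (h : I → A → ℝ) : Prop :=
  IsProfile lam h ∧
  ∀ᵐ i ∂lam, ∀ μ ∈ stdSimplex ℝ A,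
    ∑ a, μ a * u i a (socSum lam h) ≤ ∑ a, h i a * u i a (socSum lam h)

/-- A weakly dominated action. -/
def WeaklyDominated (ui : A → (A → ℝ) → ℝ) (a : A) : Prop :=
  ∃ μ ∈ stdSimplex ℝ A,
    (∀ τ ∈ stdSimplex ℝ A, ui a τ ≤ ∑ b, μ b * ui b τ) ∧
    (∃ τ ∈ stdSimplex ℝ A, ui a τ < ∑ b, μ b * ui b τ)

/-- Admissibility: almost no player puts weight on a weakly dominated action. -/
def Admissible (lam : Measure I) (u : I → A → (A → ℝ) → ℝ) (h : I → A → ℝ) : Prop :=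
  ∀ᵐ i ∂lam, ∀ a : A, WeaklyDominated (u i) a → h i a = 0

/-- Weak convergence of a sequence of measures to a Dirac measure. -/
def WeakTendstoDirac (ν : ℕ → Measure (A → ℝ)) (τ : A → ℝ) : Prop :=
  ∀ f : (A → ℝ) → ℝ, Continuous f →
    Tendsto (fun n => ∫ x, f x ∂(ν n)) atTop (nhds (f τ))

/-- Aggregate robustness. -/
def AggregateRobust (lam : Measure I) (u : I → A → (A → ℝ) → ℝ) (h : I → A → ℝ) : Prop :=
  ∀ᵐ i ∂lam, ∃ φ : ℕ → (A → ℝ) → Measure (A → ℝ),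
    (∀ n, IsPerturbation (φ n)) ∧
    (∀ τ ∈ stdSimplex ℝ A, WeakTendstoDirac (fun n => φ n τ) τ) ∧
    ∀ n, ∀ μ ∈ stdSimplex ℝ A,
      ∑ a, μ a * payM (u i) a (φ n (socSum lam h)) ≤
        ∑ a, h i a * payM (u i) a (φ n (socSum lam h))

/-- `ε`-robust perfect equilibrium with perturbed player space `Iε` and
perturbation function `φ`. -/
def IsEpsRPE (lam : Measure I) (u : I → A → (A → ℝ) → ℝ) (ε : ℝ)
    (h : I → A → ℝ) (Iε : Set I) (φ : (A → ℝ) → Measure (A → ℝ)) : Prop :=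
  IsProfile lam h ∧
  (∀ᵐ i ∂lam, ∀ a : A, 0 < h i a) ∧
  MeasurableSet Iε ∧ ENNReal.ofReal (1 - ε) < lam Iε ∧
  IsPerturbation φ ∧
  (∀ τ ∈ stdSimplex ℝ A, ENNReal.ofReal (1 - ε) ≤ φ τ {τ}) ∧
  ∀ i ∈ Iε, ∀ am al : A,
    payM (u i) am (φ (socSum lam h)) < payM (u i) al (φ (socSum lam h)) →
      h i am ≤ ε

/-- Robust perfect equilibrium. -/
def IsRPE (lam : Measure I) (u : I → A → (A → ℝ) → ℝ) (h : I → A → ℝ) : Prop :=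
  IsProfile lam h ∧
  ∃ (ε : ℕ → ℝ) (hs : ℕ → I → A → ℝ) (Is : ℕ → Set I)
      (φs : ℕ → (A → ℝ) → Measure (A → ℝ)),
    (∀ n, 0 < ε n) ∧ Tendsto ε atTop (nhds 0) ∧
    (∀ n, IsEpsRPE lam u (ε n) (hs n) (Is n) (φs n)) ∧
    (∀ᵐ i ∂lam, ∃ nk : ℕ → ℕ, StrictMono nk ∧ (∀ k, i ∈ Is (nk k)) ∧
      Tendsto (fun k => hs (nk k) i) atTop (nhds (h i))) ∧
    Tendsto (fun n => socSum lam (hs n)) atTop (nhds (socSum lam h))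

/-- The Dirac randomized strategy profile induced by a pure strategy profile. -/
def diracProfile [DecidableEq A] (f : I → A) : I → A → ℝ :=
  fun i a => if a = f i then 1 else 0

end RobustPerfect

/-- The common payoff of the three-path game. -/
noncomputable def threePath : Fin 3 → (Fin 3 → ℝ) → ℝ := fun a τ =>
  if a = 0 then -(1/2) else if a = 1 then -(max (τ 1) (1/2)) else -(τ 2) - 1/3

section Auxiliary

lemma measureReal_compl_le_of_ofReal_le {X : Type*} [MeasurableSpace X] (μ : Measure X)
    [IsProbabilityMeasure μ] {S : Set X} (hS : MeasurableSet S) {ε : ℝ}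
    (h : ENNReal.ofReal (1 - ε) ≤ μ S) : μ.real Sᶜ ≤ ε := by
  rw [probReal_compl_eq_one_sub hS]
  have := (ENNReal.ofReal_le_iff_le_toReal (measure_ne_top μ S)).1 h
  simp only [Measure.real]
  linarith

/-- A function bounded by `1` everywhere and by `δ` on a set of measure at least `1 - ε` has
integral at most `δ + ε`. -/
lemma integral_le_add_of_le_on {X : Type*} [MeasurableSpace X] (μ : Measure X)
    [IsProbabilityMeasure μ] {S : Set X} (hS : MeasurableSet S) {ε δ : ℝ} (hδ : 0 ≤ δ)
    (h : ENNReal.ofReal (1 - ε) ≤ μ S) {f : X → ℝ} (hf : Integrable f μ)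
    (h1 : ∀ᵐ x ∂μ, f x ≤ 1) (hfS : ∀ x ∈ S, f x ≤ δ) :
    ∫ x, f x ∂μ ≤ δ + ε := by
  have hint : Integrable (Sᶜ.indicator fun _ => (1 : ℝ)) μ :=
    (integrable_const _).indicator hS.compl
  calc ∫ x, f x ∂μ ≤ ∫ x, (δ + Sᶜ.indicator (fun _ => (1 : ℝ)) x) ∂μ := by
        refine integral_mono_ae hf ((integrable_const _).add hint) ?_
        filter_upwards [h1] with x hx
        by_cases hxS : x ∈ S
        · simpa [hxS] using hfS x hxS
        · simp [hxS]; linarith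
    _ = δ + μ.real Sᶜ := by
        rw [integral_add (integrable_const _) hint, integral_indicator hS.compl]
        simp
    _ ≤ δ + ε := by gcongr; exact measureReal_compl_le_of_ofReal_le μ hS h

variable {A : Type*} [Fintype A]

lemma le_one_of_mem_stdSimplex {τ : A → ℝ} (h : τ ∈ stdSimplex ℝ A) (a : A) : τ a ≤ 1 :=
  (Finset.single_le_sum (fun b _ => h.1 b) (Finset.mem_univ a)).trans_eq h.2

lemma integrable_of_continuous_of_stdSimplex {η : Measure (A → ℝ)} [IsProbabilityMeasure η]
    (hη : η (stdSimplex ℝ A)ᶜ = 0) {f : (A → ℝ) → ℝ} (hf : Continuous f) : Integrable f η := by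
  have hcpt : IsCompact (stdSimplex ℝ A) := isCompact_stdSimplex ℝ A
  obtain ⟨C, hC⟩ := hcpt.exists_bound_of_continuousOn hf.continuousOn
  refine Integrable.of_bound hf.aestronglyMeasurable C ?_
  filter_upwards [mem_ae_iff.2 hη] with x hx using hC x hx

lemma abs_integral_sub_le {η : Measure (A → ℝ)} [IsProbabilityMeasure η]
    (hη : η (stdSimplex ℝ A)ᶜ = 0) {s : A → ℝ} (hs : s ∈ stdSimplex ℝ A) {ε : ℝ}
    (h : ENNReal.ofReal (1 - ε) ≤ η {s}) (a : A) : |∫ τ, τ a ∂η - s a| ≤ ε := by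
  have hint : Integrable (fun τ : A → ℝ => τ a) η :=
    integrable_of_continuous_of_stdSimplex hη (continuous_apply a)
  have hsub : ∫ τ, τ a ∂η - s a = ∫ τ, (τ a - s a) ∂η := by
    rw [integral_sub hint (integrable_const _)]; simp
  rw [hsub]
  refine abs_integral_le_integral_abs.trans ?_
  have key := integral_le_add_of_le_on η (measurableSet_singleton s) le_rfl h
    (f := fun τ => |τ a - s a|) (hint.sub (integrable_const _)).abs ?_ ?_
  · simpa using key
  · filter_upwards [mem_ae_iff.2 hη] with x hx
    rw [abs_le]
    have h1 := hx.1 a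
    have h2 := hs.1 a
    have h3 := le_one_of_mem_stdSimplex hx a
    have h4 := le_one_of_mem_stdSimplex hs a
    constructor <;> linarith
  · rintro x rfl
    simp

lemma exists_fullSupportOnSimplex [Nonempty A] :
    ∃ η : Measure (A → ℝ), FullSupportOnSimplex η := by
  classical
  obtain ⟨a⟩ := ‹Nonempty A›
  have : Nonempty (stdSimplex ℝ A) := ⟨⟨_, single_mem_stdSimplex ℝ a⟩⟩
  let d : ℕ → A → ℝ := fun n => (TopologicalSpace.denseSeq (stdSimplex ℝ A) n : A → ℝ)
  let p : Measure ℕ := ProbabilityTheory.poissonMeasure 1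
  have hd : Measurable d := measurable_from_top
  have hsimplex : MeasurableSet (stdSimplex ℝ A) := (isClosed_stdSimplex ℝ A).measurableSet
  refine ⟨p.map d, Measure.isProbabilityMeasure_map hd.aemeasurable, ?_, ?_⟩
  · rw [Measure.map_apply hd hsimplex.compl]
    convert measure_empty (μ := p)
    exact Set.eq_empty_of_forall_notMem fun n hn =>
      hn (TopologicalSpace.denseSeq (stdSimplex ℝ A) n).2
  · rintro U hU ⟨x, hxU, hxS⟩
    obtain ⟨n, hn⟩ := (TopologicalSpace.denseRange_denseSeq (stdSimplex ℝ A)).exists_mem_open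
      (hU.preimage continuous_subtype_val) ⟨⟨x, hxS⟩, hxU⟩
    rw [Measure.map_apply hd hU.measurableSet]
    refine lt_of_lt_of_le ?_ (measure_mono (Set.singleton_subset_iff.2 (show n ∈ d ⁻¹' U from hn)))
    rw [ProbabilityTheory.poissonMeasure_singleton]
    simp only [ENNReal.ofReal_pos]
    positivity

/-- The mixture of the Dirac mass at `τ` with a fixed measure `η`. -/
noncomputable def diracMix (ε : ℝ) (η : Measure (A → ℝ)) (τ : A → ℝ) : Measure (A → ℝ) :=
  ENNReal.ofReal (1 - ε) • Measure.dirac τ + ENNReal.ofReal ε • η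

lemma ofReal_le_diracMix_singleton (ε : ℝ) (η : Measure (A → ℝ)) (τ : A → ℝ) :
    ENNReal.ofReal (1 - ε) ≤ diracMix ε η τ {τ} := by
  simp [diracMix]

lemma integral_diracMix {ε : ℝ} (h0 : 0 < ε) (h1 : ε < 1) {η : Measure (A → ℝ)}
    (hη : FullSupportOnSimplex η) {f : (A → ℝ) → ℝ} (hf : Continuous f) (τ : A → ℝ) :
    ∫ x, f x ∂(diracMix ε η τ) = (1 - ε) * f τ + ε * ∫ x, f x ∂η := by
  have := hη.1
  have hfη := integrable_of_continuous_of_stdSimplex hη.2.1 hf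
  have hfd : Integrable f (Measure.dirac τ) := integrable_dirac (by simp)
  rw [diracMix, integral_add_measure (hfd.smul_measure ENNReal.ofReal_ne_top)
    (hfη.smul_measure ENNReal.ofReal_ne_top), integral_smul_measure, integral_smul_measure,
    integral_dirac, ENNReal.toReal_ofReal h0.le, ENNReal.toReal_ofReal (by linarith)]
  simp

lemma isPerturbation_diracMix {ε : ℝ} (h0 : 0 < ε) (h1 : ε < 1) {η : Measure (A → ℝ)}
    (hη : FullSupportOnSimplex η) : IsPerturbation (diracMix ε η) := by
  have := hη.1
  refine ⟨fun τ hτ => ⟨⟨?_⟩, ?_, fun U hU hne => ?_⟩, fun f hf => ?_⟩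
  · simp only [diracMix, Measure.add_apply, Measure.smul_apply, measure_univ, smul_eq_mul, mul_one]
    rw [← ENNReal.ofReal_add (by linarith) h0.le]
    simp
  · simp [diracMix, hη.2.1, Measure.dirac_apply' τ (isClosed_stdSimplex ℝ A).measurableSet.compl, hτ]
  · have hU' := hη.2.2 U hU hne
    simp only [diracMix, Measure.add_apply, Measure.smul_apply, smul_eq_mul]
    exact lt_of_lt_of_le (ENNReal.mul_pos (by simpa using h0) hU'.ne') le_add_self
  · simp_rw [integral_diracMix h0 h1 hη hf]
    exact (hf.measurable.const_mul _).add_const _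

section Profile

variable {I : Type*} [MeasurableSpace I] {lam : Measure I} [IsProbabilityMeasure lam]

lemma IsProfile.integrable {h : I → A → ℝ} (hh : IsProfile lam h) (a : A) :
    Integrable (fun i => h i a) lam := by
  refine Integrable.of_bound ((measurable_pi_apply a).comp hh.1).aestronglyMeasurable 1 ?_
  filter_upwards with i
  rw [Real.norm_of_nonneg ((hh.2 i).1 a)]
  exact le_one_of_mem_stdSimplex (hh.2 i) a

lemma IsProfile.socSum_mem {h : I → A → ℝ} (hh : IsProfile lam h) :
    socSum lam h ∈ stdSimplex ℝ A := by
  refine ⟨fun a => integral_nonneg fun i => (hh.2 i).1 a, ?_⟩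
  simp only [socSum]
  rw [← integral_finsetSum _ fun a _ => hh.integrable a]
  simp [fun i => (hh.2 i).2]

lemma socSum_const {B : Type*} (μ : B → ℝ) : socSum lam (fun _ => μ) = μ := by
  ext a
  simp [socSum]

/-- Inferior actions receive little aggregate weight in an `ε`-robust perfect equilibrium. -/
lemma IsEpsRPE.socSum_le {u : I → A → (A → ℝ) → ℝ} {ε : ℝ} {h : I → A → ℝ} {Iε : Set I}
    {φ : (A → ℝ) → Measure (A → ℝ)} (hε : 0 < ε) (hh : IsEpsRPE lam u ε h Iε φ) {am al : A}
    (hlt : ∀ i, payM (u i) am (φ (socSum lam h)) < payM (u i) al (φ (socSum lam h))) :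
    socSum lam h am ≤ ε + ε := by
  obtain ⟨hp, -, hI, hlam, -, -, hopt⟩ := hh
  exact integral_le_add_of_le_on lam hI hε.le hlam.le (hp.integrable am)
    (ae_of_all _ fun i => le_one_of_mem_stdSimplex (hp.2 i) am)
    fun i hi => hopt i hi am al (hlt i)

end Profile

section ThreePath

variable {η : Measure (Fin 3 → ℝ)}

lemma payM_threePath_zero (hη : FullSupportOnSimplex η) : payM threePath 0 η = -(1 / 2) := by
  have := hη.1
  simp [payM, threePath]

lemma payM_threePath_two (hη : FullSupportOnSimplex η) :
    payM threePath 2 η = -∫ τ, τ 2 ∂η - 1 / 3 := by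
  have := hη.1
  have hint : Integrable (fun τ : Fin 3 → ℝ => τ 2) η :=
    integrable_of_continuous_of_stdSimplex hη.2.1 (continuous_apply 2)
  simp only [payM, threePath, Fin.reduceEq, if_false]
  rw [integral_sub (f := fun τ : Fin 3 → ℝ => -τ 2) hint.neg (integrable_const _), integral_neg]
  simp

lemma payM_threePath_one_lt_zero (hη : FullSupportOnSimplex η) :
    payM threePath 1 η < payM threePath 0 η := by
  have := hη.1
  have hcont : Continuous fun τ : Fin 3 → ℝ => max (τ 1) (1 / 2) - 1 / 2 := by fun_prop
  have hint := integrable_of_continuous_of_stdSimplex hη.2.1 hcont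
  have hpos : 0 < ∫ τ, (max (τ 1) (1 / 2) - 1 / 2) ∂η := by
    rw [integral_pos_iff_support_of_nonneg (fun τ => by simp) hint]
    have hopen : IsOpen {τ : Fin 3 → ℝ | 1 / 2 < τ 1} :=
      isOpen_lt continuous_const (continuous_apply 1)
    refine lt_of_lt_of_le (hη.2.2 _ hopen ⟨Pi.single 1 1, ?_, single_mem_stdSimplex ℝ 1⟩)
      (measure_mono fun τ hτ => ?_)
    · norm_num [Set.mem_ofPred_eq]
    · have hτ' : 1 / 2 < τ 1 := hτ
      rw [Function.mem_support, max_eq_left hτ'.le]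
      exact (sub_pos.2 hτ').ne'
  have heq : payM threePath 1 η = -(∫ τ, (max (τ 1) (1 / 2) - 1 / 2) ∂η) - 1 / 2 := by
    rw [← integral_neg]
    have : payM threePath 1 η = ∫ τ, (-(max (τ 1) (1 / 2) - 1 / 2) - 1 / 2) ∂η := by
      refine integral_congr_ae (ae_of_all _ fun τ => ?_)
      simp [threePath]
    rw [this, integral_sub (f := fun τ : Fin 3 → ℝ => -(max (τ 1) (1 / 2) - 1 / 2)) hint.neg
      (integrable_const _)]
    simp
  rw [heq, payM_threePath_zero hη]
  linarith

variable {I : Type*} [MeasurableSpace I] {lam : Measure I} [IsProbabilityMeasure lam]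

lemma isEpsRPE_threePath_const {ε : ℝ} (h0 : 0 < ε) (h1 : ε ≤ 1 / 12)
    (hη : FullSupportOnSimplex η) {μ : Fin 3 → ℝ} (hμ : μ ∈ stdSimplex ℝ (Fin 3))
    (hμpos : ∀ a, 0 < μ a) (hμ1 : μ 1 ≤ ε)
    (hμ2 : (1 - ε) * μ 2 + ε * ∫ τ, τ 2 ∂η = 1 / 6) :
    IsEpsRPE lam (fun _ : I => threePath) ε (fun _ => μ) Set.univ (diracMix ε η) := by
  have hφ := isPerturbation_diracMix h0 (by linarith) hη
  refine ⟨⟨measurable_const, fun _ => hμ⟩, ae_of_all _ fun _ => hμpos, MeasurableSet.univ, ?_, hφ,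
    fun τ _ => ofReal_le_diracMix_singleton ε η τ, fun i _ am al hlt => ?_⟩
  · rw [measure_univ, ENNReal.ofReal_lt_one]
    linarith
  · rw [socSum_const] at hlt
    have e0 := payM_threePath_zero (hφ.1 μ hμ)
    have e1 := payM_threePath_one_lt_zero (hφ.1 μ hμ)
    have e2 := payM_threePath_two (hφ.1 μ hμ)
    rw [integral_diracMix h0 (by linarith) hη (continuous_apply 2), hμ2] at e2
    fin_cases am
    · fin_cases al <;> simp at hlt <;> linarith
    · exact hμ1
    · fin_cases al <;> simp at hlt <;> linarith

lemma isRPE_threePath_const :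
    IsRPE lam (fun _ : I => threePath) (fun _ => ![5/6, 0, 1/6]) := by
  obtain ⟨η, hη⟩ := exists_fullSupportOnSimplex (A := Fin 3)
  have := hη.1
  set m : ℝ := ∫ τ, τ 2 ∂η
  have hm0 : 0 ≤ m := integral_nonneg_of_ae <| by
    filter_upwards [mem_ae_iff.2 hη.2.1] with x hx using hx.1 2
  have hm1 : m ≤ 1 := by
    have hint : Integrable (fun τ : Fin 3 → ℝ => τ 2) η :=
      integrable_of_continuous_of_stdSimplex hη.2.1 (continuous_apply 2)
    have := integral_mono_ae hint (integrable_const (1 : ℝ)) <| by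
      filter_upwards [mem_ae_iff.2 hη.2.1] with x hx using le_one_of_mem_stdSimplex hx 2
    simpa using this
  let c : ℝ → ℝ := fun ε => (1 / 6 - ε * m) / (1 - ε)
  let ε : ℕ → ℝ := fun n => (1 / 12) * (1 / ((n : ℝ) + 1))
  have hεpos : ∀ n, 0 < ε n := fun n => by positivity
  have hεle : ∀ n, ε n ≤ 1 / 12 := fun n => by
    have : 1 / ((n : ℝ) + 1) ≤ 1 := by
      rw [div_le_one (by positivity)]
      linarith [n.cast_nonneg (α := ℝ)]
    simp only [ε]
    linarith
  have hεlim : Tendsto ε atTop (nhds 0) := by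
    simpa [ε] using (tendsto_one_div_add_atTop_nhds_zero_nat (𝕜 := ℝ)).const_mul (12⁻¹)
  have hcpos : ∀ n, 0 < c (ε n) := fun n =>
    div_pos (by nlinarith [hεpos n, hεle n]) (by linarith [hεle n])
  have hcle : ∀ n, c (ε n) ≤ 1 / 2 := fun n => by
    have := hεle n
    have := mul_nonneg (hεpos n).le hm0
    simp only [c]
    rw [div_le_iff₀ (by linarith)]
    linarith
  have hcmul : ∀ n, (1 - ε n) * c (ε n) + ε n * m = 1 / 6 := fun n => by
    have : 1 - ε n ≠ 0 := by linarith [hεle n]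
    simp only [c]
    field_simp
    ring
  have hclim : Tendsto (fun n => c (ε n)) atTop (nhds (1 / 6)) := by
    have : Tendsto c (nhds 0) (nhds (c 0)) :=
      ContinuousAt.div (by fun_prop) (by fun_prop) (by norm_num)
    simpa [c, Function.comp_def] using this.comp hεlim
  let μ : ℕ → Fin 3 → ℝ := fun n => ![1 - ε n - c (ε n), ε n, c (ε n)]
  have hμpos : ∀ n a, 0 < μ n a := fun n a => by
    fin_cases a
    · simp only [μ, Fin.zero_eta, Matrix.cons_val_zero]
      linarith [hεle n, hcle n]
    · exact hεpos n
    · exact hcpos n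
  have hμmem : ∀ n, μ n ∈ stdSimplex ℝ (Fin 3) := fun n =>
    ⟨fun a => (hμpos n a).le, by simp [μ, Fin.sum_univ_three]; ring⟩
  have hμlim : Tendsto μ atTop (nhds ![5/6, 0, 1/6]) := by
    rw [tendsto_pi_nhds]
    intro a
    fin_cases a
    · have := ((tendsto_const_nhds (x := (1 : ℝ))).sub hεlim).sub hclim
      norm_num at this
      simpa [μ] using this
    · simpa [μ] using hεlim
    · simpa [μ] using hclim
  refine ⟨⟨measurable_const, fun _ => ⟨fun a => ?_, ?_⟩⟩, ε, fun n _ => μ n, fun _ => Set.univ,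
    fun n => diracMix (ε n) η, hεpos, hεlim, fun n => ?_, ?_, ?_⟩
  · fin_cases a <;> norm_num
  · simp [Fin.sum_univ_three]
    norm_num
  · exact isEpsRPE_threePath_const (hεpos n) (hεle n) hη (hμmem n) (hμpos n) le_rfl (hcmul n)
  · exact ae_of_all _ fun i => ⟨id, strictMono_id, fun _ => Set.mem_univ _, hμlim⟩
  · simpa only [socSum_const] using hμlim

lemma IsRPE.socSum_threePath {h : I → Fin 3 → ℝ} (hh : IsRPE lam (fun _ : I => threePath) h) :
    socSum lam h = ![5/6, 0, 1/6] := by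
  obtain ⟨hp, ε, hs, Is, φs, hεpos, hεlim, hE, -, hlim⟩ := hh
  have hlim' := tendsto_pi_nhds.1 hlim
  have hε2 : Tendsto (fun n => ε n + ε n) atTop (nhds 0) := by simpa using hεlim.add hεlim
  have hmem : socSum lam h ∈ stdSimplex ℝ (Fin 3) := hp.socSum_mem
  have hsmem : ∀ n, socSum lam (hs n) ∈ stdSimplex ℝ (Fin 3) := fun n => (hE n).1.socSum_mem
  have hfull : ∀ n, FullSupportOnSimplex (φs n (socSum lam (hs n))) := fun n =>
    (hE n).2.2.2.2.1.1 _ (hsmem n)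
  have hsum : socSum lam h 0 + socSum lam h 1 + socSum lam h 2 = 1 := by
    simpa [Fin.sum_univ_three] using hmem.2
  have hb : socSum lam h 1 = 0 := by
    refine le_antisymm (le_of_tendsto_of_tendsto' (hlim' 1) hε2 fun n => ?_) (hmem.1 1)
    exact (hE n).socSum_le (hεpos n) fun _ => payM_threePath_one_lt_zero (hfull n)
  have hdev : ∀ n, |∫ τ, τ 2 ∂(φs n (socSum lam (hs n))) - socSum lam (hs n) 2| ≤ ε n := fun n =>
    have := (hfull n).1
    abs_integral_sub_le (hfull n).2.1 (hsmem n) ((hE n).2.2.2.2.2.1 _ (hsmem n)) 2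
  have hmean : Tendsto (fun n => ∫ τ, τ 2 ∂(φs n (socSum lam (hs n)))) atTop
      (nhds (socSum lam h 2)) := by
    have hdiff := squeeze_zero_norm (f := fun n => ∫ τ, τ 2 ∂(φs n (socSum lam (hs n))) -
      socSum lam (hs n) 2) hdev hεlim
    simpa using hdiff.add (hlim' 2)
  have hc : socSum lam h 2 = 1 / 6 := by
    rcases lt_trichotomy (socSum lam h 2) (1 / 6) with hlt | heq | hgt
    · have ha : socSum lam h 0 ≤ 0 := by
        refine le_of_tendsto_of_tendsto (hlim' 0) hε2 ?_
        filter_upwards [hmean.eventually_lt_const hlt] with n hn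
        refine (hE n).socSum_le (al := 2) (hεpos n) fun _ => ?_
        rw [payM_threePath_zero (hfull n), payM_threePath_two (hfull n)]
        linarith
      linarith
    · exact heq
    · have ha : socSum lam h 2 ≤ 0 := by
        refine le_of_tendsto_of_tendsto (hlim' 2) hε2 ?_
        filter_upwards [hmean.eventually_const_lt hgt] with n hn
        refine (hE n).socSum_le (al := 0) (hεpos n) fun _ => ?_
        rw [payM_threePath_zero (hfull n), payM_threePath_two (hfull n)]
        linarith
      linarith
  ext a
  fin_cases a
  · simp only [Fin.zero_eta, Matrix.cons_val_zero]
    linarith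
  · exact hb
  · exact hc

end ThreePath

end Auxiliary

/-- In the three-path game, the constant profile
`(5/6, 0, 1/6)` is a robust perfect equilibrium; it is the unique symmetric
robust perfect equilibrium (almost everywhere); and every robust perfect
equilibrium induces the traffic flow `(5/6, 0, 1/6)`. -/
theorem statement17 {I : Type*} [MeasurableSpace I]
    (lam : Measure I) [IsProbabilityMeasure lam] (hatomless : MeasAtomless lam) :
    IsRPE lam (fun _ : I => threePath) (fun _ => ![5/6, 0, 1/6]) ∧
    (∀ h : I → Fin 3 → ℝ, IsRPE lam (fun _ : I => threePath) h →
      (∀ i i' : I, (fun _ : I => threePath) i = (fun _ : I => threePath) i' → h i = h i') →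
      ∀ᵐ i ∂lam, h i = ![5/6, 0, 1/6]) ∧
    (∀ h : I → Fin 3 → ℝ, IsRPE lam (fun _ : I => threePath) h →
      socSum lam h = ![5/6, 0, 1/6]) := by
  refine ⟨isRPE_threePath_const, fun h hh hsymm => ae_of_all _ fun i => ?_,
    fun h hh => hh.socSum_threePath⟩
  have hconst : h = fun _ => h i := funext fun j => hsymm j i rfl
  have hs := hh.socSum_threePath
  rwa [hconst, socSum_const] at hs
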